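/- (Half-space case of Theorem 2.1, Dirichlet condition.) Let d ≥ 2, V : ℝ^d → ℝ smooth, and f ∈ C_c^∞(ℝ^d) satisfying the Dirichlet condition f(x̂, 0) = 0 for all x̂ ∈ ℝ^{d−1}. Then ∫_H { (Lf)² − ‖Hess_f‖²_HS + Hess_V(∇f, ∇f) } dμ = − ∫_{ℝ^{d−1}} ∂_d V(x̂,0) · (∂_d f(x̂,0))² dμ_∂. -/

import Mathlib

open MeasureTheory Real

/-- Partial derivative `∂ᵢ f` on `ℝ^n = Fin n → ℝ`. -/
noncomputable def pd {n : ℕ} (i : Fin n) (f : (Fin n → ℝ) → ℝ) (x : Fin n → ℝ) : ℝ :=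
  fderiv ℝ f x (Pi.single i 1)

/-- Hessian entry `∂ᵢ∂ⱼ f`. -/
noncomputable def hess {n : ℕ} (i j : Fin n) (f : (Fin n → ℝ) → ℝ) (x : Fin n → ℝ) : ℝ :=
  pd i (pd j f) x

/-- Euclidean Laplacian `Δf`. -/
noncomputable def lap {n : ℕ} (f : (Fin n → ℝ) → ℝ) (x : Fin n → ℝ) : ℝ :=
  ∑ i, hess i i f x

/-- Weighted Laplacian `L f = Δ f + ⟨∇V, ∇f⟩`. -/
noncomputable def Lop {n : ℕ} (V f : (Fin n → ℝ) → ℝ) (x : Fin n → ℝ) : ℝ :=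
  lap f x + ∑ i, pd i V x * pd i f x

/-- Squared Hilbert-Schmidt norm of the Hessian of `f`. -/
noncomputable def hessHS2 {n : ℕ} (f : (Fin n → ℝ) → ℝ) (x : Fin n → ℝ) : ℝ :=
  ∑ i, ∑ j, (hess i j f x) ^ 2

/-- The Hessian of `V` as a bilinear form evaluated at vectors `u, v`. -/
noncomputable def hessBil {n : ℕ} (V : (Fin n → ℝ) → ℝ) (x : Fin n → ℝ)
    (u v : Fin n → ℝ) : ℝ :=
  ∑ i, ∑ j, hess i j V x * u i * v j

/-- The gradient `∇f`. -/
noncomputable def grad {n : ℕ} (f : (Fin n → ℝ) → ℝ) (x : Fin n → ℝ) : Fin n → ℝ :=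
  fun i => pd i f x

/-- The closed upper half-space `H = {x ∈ ℝ^{d+1} : x_{d+1} ≥ 0}`. -/
def upperHalf (d : ℕ) : Set (Fin (d + 1) → ℝ) := {x | 0 ≤ x (Fin.last d)}

section PartialDerivatives

variable {n : ℕ} {f g : (Fin n → ℝ) → ℝ} {x : Fin n → ℝ}

lemma pd_add (i : Fin n) (hf : DifferentiableAt ℝ f x) (hg : DifferentiableAt ℝ g x) :
    pd i (fun y => f y + g y) x = pd i f x + pd i g x := by
  simp [pd, fderiv_fun_add hf hg]

lemma pd_sub (i : Fin n) (hf : DifferentiableAt ℝ f x) (hg : DifferentiableAt ℝ g x) :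
    pd i (fun y => f y - g y) x = pd i f x - pd i g x := by
  simp [pd, fderiv_fun_sub hf hg]

lemma pd_mul (i : Fin n) (hf : DifferentiableAt ℝ f x) (hg : DifferentiableAt ℝ g x) :
    pd i (fun y => f y * g y) x = pd i f x * g x + f x * pd i g x := by
  simp [pd, fderiv_fun_mul hf hg]
  ring

lemma pd_exp (i : Fin n) (hf : DifferentiableAt ℝ f x) :
    pd i (fun y => exp (f y)) x = exp (f x) * pd i f x := by
  simp [pd, fderiv_exp hf]

lemma pd_sum (i : Fin n) {ι : Type*} {s : Finset ι} {F : ι → (Fin n → ℝ) → ℝ}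
    (hF : ∀ j ∈ s, DifferentiableAt ℝ (F j) x) :
    pd i (fun y => ∑ j ∈ s, F j y) x = ∑ j ∈ s, pd i (F j) x := by
  simp [pd, fderiv_fun_sum hF]

lemma contDiff_pd (i : Fin n) (hf : ContDiff ℝ (⊤ : ℕ∞) f) : ContDiff ℝ (⊤ : ℕ∞) (pd i f) :=
  (hf.fderiv_right (by simp)).clm_apply contDiff_const

lemma pd_comm (i j : Fin n) (hf : ContDiff ℝ (⊤ : ℕ∞) f) : pd i (pd j f) = pd j (pd i f) := by
  ext x
  have hd : DifferentiableAt ℝ (fderiv ℝ f) x :=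
    ((hf.fderiv_right (m := 1) (by norm_cast)).differentiable (by simp)).differentiableAt
  have key (v w : Fin n → ℝ) :
      fderiv ℝ (fun y => fderiv ℝ f y v) x w = fderiv ℝ (fderiv ℝ f) x w v := by
    simp [fderiv_clm_apply hd (differentiableAt_const v)]
  change fderiv ℝ (fun y => fderiv ℝ f y (Pi.single j 1)) x (Pi.single i 1)
    = fderiv ℝ (fun y => fderiv ℝ f y (Pi.single i 1)) x (Pi.single j 1)
  rw [key, key]
  have h2 : ContDiff ℝ 2 f := contDiff_infty.1 hf 2
  exact (h2.contDiffAt.isSymmSndFDerivAt (by simp)).eq _ _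

end PartialDerivatives

/-- The divergence theorem on the upper half-space for compactly supported `C¹` vector fields. -/
lemma integral_upperHalf_divergence {d : ℕ} (X : Fin (d + 1) → (Fin (d + 1) → ℝ) → ℝ)
    (hX : ∀ i, ContDiff ℝ 1 (X i)) (hc : ∀ i, HasCompactSupport (X i)) :
    ∫ x in upperHalf d, ∑ i, pd i (X i) x = -∫ xb : Fin d → ℝ, X (Fin.last d) (Fin.snoc xb 0) := by
  obtain ⟨R, hR0, hR⟩ : ∃ R : ℝ, 0 < R ∧ ∀ i x, R ≤ ‖x‖ → x ∉ tsupport (X i) := by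
    have hK : IsCompact (⋃ i, tsupport (X i)) := isCompact_iUnion hc
    obtain ⟨R, hR0, hR⟩ := hK.isBounded.exists_pos_norm_lt
    exact ⟨R, hR0, fun i x hx hxi => (hR x (Set.mem_iUnion.2 ⟨i, hxi⟩)).not_ge hx⟩
  have hX0 : ∀ i x j, R ≤ |x j| → X i x = 0 := fun i x j hj =>
    image_eq_zero_of_notMem_tsupport (hR i x (hj.trans (norm_le_pi_norm x j)))
  have hpd0 : ∀ i x j, R ≤ |x j| → pd i (X i) x = 0 := fun i x j hj => by
    have h := hR i x (hj.trans (norm_le_pi_norm x j))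
    have : fderiv ℝ (X i) x = 0 := by
      by_contra h'
      exact h (support_fderiv_subset ℝ h')
    simp [pd, this]
  have hcont : Continuous fun x => ∑ i, pd i (X i) x :=
    continuous_finsetSum _ fun i _ =>
      ((hX i).continuous_fderiv (by simp)).clm_apply continuous_const
  set a : Fin (d + 1) → ℝ := Fin.snoc (fun _ => -R) 0 with ha
  set b : Fin (d + 1) → ℝ := fun _ => R with hb
  have hab : a ≤ b := by
    intro i
    refine Fin.lastCases ?_ (fun j => ?_) i <;> simp [ha, hb] <;> linarith
  have hdiv := integral_divergence_of_hasFDerivAt_off_countable' a b hab X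
    (fun i x => fderiv ℝ (X i) x) ∅ Set.countable_empty
    (fun i => (hX i).continuous.continuousOn)
    (fun x _ i => ((hX i).differentiable (by simp) x).hasFDerivAt)
    (hcont.continuousOn.integrableOn_compact isCompact_Icc)
  have hback (i : Fin (d + 1)) (x : Fin d → ℝ) : X i (i.insertNth (b i) x) = 0 :=
    hX0 i _ i (by simp [hb, le_abs_self])
  have hfront (j : Fin d) (x : Fin d → ℝ) :
      X j.castSucc (j.castSucc.insertNth (a j.castSucc) x) = 0 :=
    hX0 _ _ j.castSucc (by simp [ha, le_abs_self])
  have hbox : ∫ x in upperHalf d, ∑ i, pd i (X i) x = ∫ x in Set.Icc a b, ∑ i, pd i (X i) x := by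
    refine setIntegral_eq_of_subset_of_forall_sdiff_eq_zero
      (measurableSet_le measurable_const (measurable_pi_apply _)) (fun x hx => ?_) ?_
    · simpa [ha, upperHalf] using hx.1 (Fin.last d)
    · rintro x ⟨hx, hxI⟩
      have hx' : 0 ≤ x (Fin.last d) := hx
      obtain ⟨j, hj⟩ : ∃ j, R ≤ |x j| := by
        by_contra! h
        refine hxI ⟨fun i => ?_, fun i => (abs_lt.1 (h i)).2.le⟩
        refine Fin.lastCases ?_ (fun j => ?_) i
        · simpa [ha] using hx'
        · simpa [ha] using (abs_lt.1 (h j.castSucc)).1.le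
      exact Finset.sum_eq_zero fun i _ => hpd0 i x j hj
  have hface : ∫ x in Set.Icc (a ∘ (Fin.last d).succAbove) (b ∘ (Fin.last d).succAbove),
      X (Fin.last d) (Fin.snoc x 0) = ∫ xb : Fin d → ℝ, X (Fin.last d) (Fin.snoc xb 0) := by
    refine setIntegral_eq_integral_of_forall_compl_eq_zero fun x hx => ?_
    obtain ⟨j, hj⟩ : ∃ j, R ≤ |x j| := by
      by_contra! h
      refine hx ⟨fun i => ?_, fun i => (abs_lt.1 (h i)).2.le⟩
      simpa [ha] using (abs_lt.1 (h i)).1.le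
    exact hX0 _ _ j.castSucc (by simpa using hj)
  rw [hbox, ← hface]
  refine hdiv.trans ?_
  rw [Fin.sum_univ_castSucc]
  simp only [hback, hfront, integral_zero, sub_zero, Finset.sum_const_zero, zero_sub, zero_add]
  simp [ha, Fin.insertNth_last']

/-- The `i`-th component of the vector field `e^V (L f ∇f - Hess_f ∇f)`. -/
noncomputable def bochnerField {n : ℕ} (V f : (Fin n → ℝ) → ℝ) (i : Fin n) (x : Fin n → ℝ) : ℝ :=
  (Lop V f x * pd i f x - ∑ j, pd j f x * hess i j f x) * exp (V x)

section Bochner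

variable {n : ℕ} {V f : (Fin n → ℝ) → ℝ}

lemma contDiff_hess (i j : Fin n) (hf : ContDiff ℝ (⊤ : ℕ∞) f) :
    ContDiff ℝ (⊤ : ℕ∞) (hess i j f) :=
  contDiff_pd i (contDiff_pd j hf)

lemma contDiff_Lop (hV : ContDiff ℝ (⊤ : ℕ∞) V) (hf : ContDiff ℝ (⊤ : ℕ∞) f) :
    ContDiff ℝ (⊤ : ℕ∞) (Lop V f) :=
  (ContDiff.sum fun i _ => contDiff_hess i i hf).add
    (ContDiff.sum fun i _ => (contDiff_pd i hV).mul (contDiff_pd i hf))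

lemma contDiff_bochnerField (hV : ContDiff ℝ (⊤ : ℕ∞) V) (hf : ContDiff ℝ (⊤ : ℕ∞) f)
    (i : Fin n) : ContDiff ℝ (⊤ : ℕ∞) (bochnerField V f i) :=
  (((contDiff_Lop hV hf).mul (contDiff_pd i hf)).sub
    (ContDiff.sum fun j _ => (contDiff_pd j hf).mul (contDiff_hess i j hf))).mul hV.exp

lemma hasCompactSupport_bochnerField (hfc : HasCompactSupport f) (i : Fin n) :
    HasCompactSupport (bochnerField V f i) := by
  refine hfc.mono' fun x hx => ?_
  by_contra h
  have hpd (j : Fin n) : pd j f x = 0 := by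
    have : fderiv ℝ f x = 0 := by
      by_contra h'
      exact h (support_fderiv_subset ℝ h')
    simp [pd, this]
  exact hx (by simp [bochnerField, hpd])

lemma pd_Lop (hV : ContDiff ℝ (⊤ : ℕ∞) V) (hf : ContDiff ℝ (⊤ : ℕ∞) f) (i : Fin n)
    (x : Fin n → ℝ) :
    pd i (Lop V f) x = ∑ j, pd i (hess j j f) x
      + ∑ j, (hess i j V x * pd j f x + pd j V x * hess i j f x) := by
  have htop : ((⊤ : ℕ∞) : WithTop ℕ∞) ≠ 0 := by simp
  have hh (j k : Fin n) : DifferentiableAt ℝ (hess j k f) x :=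
    (contDiff_hess j k hf).differentiable htop x
  have hf1 (j : Fin n) : DifferentiableAt ℝ (pd j f) x := (contDiff_pd j hf).differentiable htop x
  have hV1 (j : Fin n) : DifferentiableAt ℝ (pd j V) x := (contDiff_pd j hV).differentiable htop x
  change pd i (fun y => ∑ j, hess j j f y + ∑ j, pd j V y * pd j f y) x = _
  rw [pd_add i (DifferentiableAt.fun_sum fun j _ => hh j j)
      (DifferentiableAt.fun_sum fun j _ => (hV1 j).fun_mul (hf1 j)),
    pd_sum i fun j _ => hh j j, pd_sum i fun j _ => (hV1 j).fun_mul (hf1 j)]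
  simp only [fun j => pd_mul i (hV1 j) (hf1 j), hess]

lemma pd_bochnerField (hV : ContDiff ℝ (⊤ : ℕ∞) V) (hf : ContDiff ℝ (⊤ : ℕ∞) f) (i : Fin n)
    (x : Fin n → ℝ) :
    pd i (bochnerField V f i) x =
      (pd i (Lop V f) x * pd i f x + Lop V f x * hess i i f x
        - ∑ j, (hess i j f x ^ 2 + pd j f x * pd j (hess i i f) x)
        + (Lop V f x * pd i f x - ∑ j, pd j f x * hess i j f x) * pd i V x) * exp (V x) := by
  have htop : ((⊤ : ℕ∞) : WithTop ℕ∞) ≠ 0 := by simp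
  have hh (j k : Fin n) : DifferentiableAt ℝ (hess j k f) x :=
    (contDiff_hess j k hf).differentiable htop x
  have hf1 (j : Fin n) : DifferentiableAt ℝ (pd j f) x := (contDiff_pd j hf).differentiable htop x
  have hV0 : DifferentiableAt ℝ V x := hV.differentiable htop x
  have hL : DifferentiableAt ℝ (Lop V f) x := (contDiff_Lop hV hf).differentiable htop x
  have hS : DifferentiableAt ℝ (fun y => ∑ j, pd j f y * hess i j f y) x :=
    DifferentiableAt.fun_sum fun j _ => (hf1 j).fun_mul (hh i j)
  have hthird (j : Fin n) : pd i (hess i j f) x = pd j (hess i i f) x := by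
    unfold hess
    rw [pd_comm i j hf, pd_comm i j (contDiff_pd i hf)]
  change pd i (fun y => (Lop V f y * pd i f y - ∑ j, pd j f y * hess i j f y) * exp (V y)) x = _
  rw [pd_mul i ((hL.fun_mul (hf1 i)).fun_sub hS) hV0.exp, pd_exp i hV0, pd_sub i (hL.fun_mul (hf1 i)) hS,
    pd_mul i hL (hf1 i), pd_sum i fun j _ => (hf1 j).fun_mul (hh i j)]
  simp only [fun j => pd_mul i (hf1 j) (hh i j), hthird]
  simp only [hess, sq]
  ring

lemma sum_pd_bochnerField (hV : ContDiff ℝ (⊤ : ℕ∞) V) (hf : ContDiff ℝ (⊤ : ℕ∞) f)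
    (x : Fin n → ℝ) :
    ∑ i, pd i (bochnerField V f i) x =
      ((Lop V f x) ^ 2 - hessHS2 f x + hessBil V x (grad f x) (grad f x)) * exp (V x) := by
  simp only [pd_bochnerField hV hf, ← Finset.sum_mul]
  congr 1
  simp only [pd_Lop hV hf]
  have hL : Lop V f x ^ 2 = ∑ i, Lop V f x * (hess i i f x + pd i V x * pd i f x) := by
    rw [← Finset.mul_sum, Finset.sum_add_distrib, sq]
    rfl
  have hsymm (i j : Fin n) : hess i j f x = hess j i f x := congrFun (pd_comm i j hf) x
  have hT : ∑ i, ∑ j, pd i (hess j j f) x * pd i f x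
      = ∑ i, ∑ j, pd j f x * pd j (hess i i f) x := by
    rw [Finset.sum_comm]
    simp only [mul_comm]
  have hQ : ∑ i, ∑ j, pd j V x * hess i j f x * pd i f x
      = ∑ i, ∑ j, pd j f x * hess i j f x * pd i V x := by
    rw [Finset.sum_comm]
    refine Finset.sum_congr rfl fun i _ => Finset.sum_congr rfl fun j _ => ?_
    rw [hsymm j i]
    ring
  have hB : hessBil V x (grad f x) (grad f x) = ∑ i, ∑ j, hess i j V x * pd j f x * pd i f x := by
    refine Finset.sum_congr rfl fun i _ => Finset.sum_congr rfl fun j _ => ?_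
    simp only [grad]
    ring
  rw [hL, hB, hessHS2]
  generalize Lop V f x = l
  simp only [add_mul, sub_mul, mul_add, Finset.sum_mul, Finset.sum_add_distrib,
    Finset.sum_sub_distrib]
  rw [hT, hQ]
  have : ∑ i, l * pd i f x * pd i V x = ∑ i, l * (pd i V x * pd i f x) :=
    Finset.sum_congr rfl fun i _ => by ring
  rw [this]
  ring

end Bochner

/-- Tangential derivatives vanish along the boundary hyperplane together with the function. -/
lemma pd_castSucc_snoc_eq_zero {d : ℕ} {g : (Fin (d + 1) → ℝ) → ℝ} (hg : Differentiable ℝ g)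
    (h0 : ∀ xb : Fin d → ℝ, g (Fin.snoc xb 0) = 0) (j : Fin d) (xb : Fin d → ℝ) :
    pd j.castSucc g (Fin.snoc xb 0) = 0 := by
  have hline : ∀ t : ℝ, (Fin.snoc xb 0 : Fin (d + 1) → ℝ) + t • Pi.single j.castSucc 1
      = Fin.snoc (xb + t • Pi.single j 1 : Fin d → ℝ) 0 := by
    intro t
    ext k
    refine Fin.lastCases ?_ (fun k => ?_) k
    · simp [(Fin.castSucc_lt_last j).ne']
    · simp [Pi.single_apply]
  have h := (hg (Fin.snoc xb 0)).lineDeriv_eq_fderiv (v := Pi.single j.castSucc 1)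
  rw [pd]
  refine h.symm.trans ?_
  rw [lineDeriv]
  simp only [hline, h0, deriv_const]

lemma bochnerField_last_snoc {d : ℕ} {V f : (Fin (d + 1) → ℝ) → ℝ}
    (hf : ContDiff ℝ (⊤ : ℕ∞) f) (h0 : ∀ xb : Fin d → ℝ, f (Fin.snoc xb 0) = 0)
    (xb : Fin d → ℝ) :
    bochnerField V f (Fin.last d) (Fin.snoc xb 0) =
      pd (Fin.last d) V (Fin.snoc xb 0) * (pd (Fin.last d) f (Fin.snoc xb 0)) ^ 2
        * exp (V (Fin.snoc xb 0)) := by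
  have htop : ((⊤ : ℕ∞) : WithTop ℕ∞) ≠ 0 := by simp
  have h1 (j : Fin d) (yb : Fin d → ℝ) : pd j.castSucc f (Fin.snoc yb 0) = 0 :=
    pd_castSucc_snoc_eq_zero (hf.differentiable htop) h0 j yb
  have h2 (j : Fin d) : hess j.castSucc j.castSucc f (Fin.snoc xb 0) = 0 :=
    pd_castSucc_snoc_eq_zero ((contDiff_pd _ hf).differentiable htop) (h1 j) j xb
  simp only [bochnerField, Lop, lap, Fin.sum_univ_castSucc, h1, h2]
  simp
  ring

/-- half-space case of Theorem 2.1, Dirichlet condition: for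
`f ∈ C_c^∞` vanishing on the boundary,
`∫_H { (Lf)² − ‖Hess_f‖²_HS + Hess_V(∇f, ∇f) } dμ
  = − ∫_{ℝ^{d−1}} ∂_d V(xb,0) (∂_d f(xb,0))² dμ_∂`,
where `μ = e^V dx` and `μ_∂ = e^{V(xb,0)} dxb`.
(Ambient dimension is `d + 1` with `d ≥ 1`, i.e. dimension `≥ 2`.) -/
theorem half_space_dirichlet_identity
    (d : ℕ) (hd : 1 ≤ d) (V f : (Fin (d + 1) → ℝ) → ℝ)
    (hV : ContDiff ℝ (⊤ : ℕ∞) V) (hf : ContDiff ℝ (⊤ : ℕ∞) f) (hfc : HasCompactSupport f)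
    (hDirichlet : ∀ xb : Fin d → ℝ, f (Fin.snoc xb 0) = 0) :
    ∫ x in upperHalf d,
        ((Lop V f x) ^ 2 - hessHS2 f x + hessBil V x (grad f x) (grad f x))
          * exp (V x)
      = -∫ xb : Fin d → ℝ,
          pd (Fin.last d) V (Fin.snoc xb 0) * (pd (Fin.last d) f (Fin.snoc xb 0)) ^ 2
            * exp (V (Fin.snoc xb 0)) := by
  simp only [← sum_pd_bochnerField hV hf, ← bochnerField_last_snoc hf hDirichlet]
  exact integral_upperHalf_divergence _
    (fun i => (contDiff_bochnerField hV hf i).of_le (by norm_cast))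
    (hasCompactSupport_bochnerField hfc)
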